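/- arXiv:0712.2021 — 2 statements merged into one kernel-verified Lean document; each statement's English description precedes it below -/
import Mathlib

section
/- Let M be a Z^d-graded module over the semigroup ring S_A = C[N A] such that the function b ↦ dim_C(M_b) on Z^d is bounded. Then M admits an exhaustive increasing filtration 0 = M_0 ⊆ M_1 ⊆ … by Z^d-graded submodules such that each quotient M_{s+1}/M_s is isomorphic to a Z^d-degree-shifted face ring S_F(b_s) for some face F of A, and for every β ∈ Z^d the set {s : -β ∈ qdeg(M_{s+1}/M_s)} is finite. (I.e., M is weakly toric.) -/
open scoped BigOperators

def col {d n : ℕ} (A : Matrix (Fin d) (Fin n) ℤ) (j : Fin n) : Fin d → ℤ := fun i => A i j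

noncomputable def posPt {n : ℕ} (u : Fin n → ℤ) : Fin n →₀ ℕ :=
  Finsupp.equivFunOnFinite.symm fun j => (u j).toNat

/-- The toric ideal `I_A ⊆ ℂ[∂]`. -/
noncomputable def toricIdeal {d n : ℕ} (A : Matrix (Fin d) (Fin n) ℤ) :
    Ideal (MvPolynomial (Fin n) ℂ) :=
  Ideal.span {p | ∃ u : Fin n → ℤ, A.mulVec u = 0 ∧
    p = MvPolynomial.monomial (posPt u) 1 - MvPolynomial.monomial (posPt (-u)) 1}

/-- The semigroup ring `S_A = ℂ[ℕA] = ℂ[∂]/I_A`. -/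
noncomputable abbrev SAring {d n : ℕ} (A : Matrix (Fin d) (Fin n) ℤ) :=
  MvPolynomial (Fin n) ℂ ⧸ toricIdeal A

/-- The semigroup `ℕF` generated by the columns in `F`. -/
def NFsg {d n : ℕ} (A : Matrix (Fin d) (Fin n) ℤ) (F : Finset (Fin n)) :
    AddSubmonoid (Fin d → ℤ) :=
  AddSubmonoid.closure (col A '' F)

/-- `F` is a face of `A`: cut out by a supporting functional. -/
def isFace {d n : ℕ} (A : Matrix (Fin d) (Fin n) ℤ) (F : Finset (Fin n)) : Prop :=
  ∃ h : Fin d → ℤ, (∀ j : Fin n, 0 ≤ ∑ i, h i * A i j) ∧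
    ∀ j : Fin n, j ∈ F ↔ ∑ i, h i * A i j = 0

/-- The face prime `I_A^F/I_A = ⟨∂_j : j ∉ F⟩ ⊆ S_A`, the annihilator of the
generator of the face ring `S_F` as a cyclic `S_A`-module. -/
noncomputable def facePrime {d n : ℕ} (A : Matrix (Fin d) (Fin n) ℤ)
    (F : Finset (Fin n)) : Ideal (SAring A) :=
  Ideal.span {x | ∃ j ∉ F, x = Ideal.Quotient.mk (toricIdeal A) (MvPolynomial.X j)}

/-- Zariski closure in `ℂ^d` of a set of lattice points. -/
def zariskiClosure {d : ℕ} (S : Set (Fin d → ℤ)) : Set (Fin d → ℂ) :=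
  {z | ∀ p : MvPolynomial (Fin d) ℂ,
    (∀ v ∈ S, MvPolynomial.eval (fun i => (v i : ℂ)) p = 0) → MvPolynomial.eval z p = 0}

/-- `qdeg S_F(b)`: the Zariski closure of `b - ℕF`, the quasi-degrees of the shifted
face ring with generator in degree `b` (with `deg ∂_j = -a_j`). -/
def qdegFace {d n : ℕ} (A : Matrix (Fin d) (Fin n) ℤ) (F : Finset (Fin n))
    (b : Fin d → ℤ) : Set (Fin d → ℂ) :=
  zariskiClosure {c | ∃ v ∈ NFsg A F, c = b - v}

section Monomials

variable {d n : ℕ} (A : Matrix (Fin d) (Fin n) ℤ)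

/-- The class of the monomial `∂^v` in `S_A`. -/
noncomputable def toricMonomial (v : Fin n →₀ ℕ) : SAring A :=
  Ideal.Quotient.mk (toricIdeal A) (MvPolynomial.monomial v 1)

/-- The `A`-degree `A v` of an exponent vector. -/
def expDegree (v : Fin n →₀ ℕ) : Fin d → ℤ := A.mulVec fun j => (v j : ℤ)

lemma toricMonomial_zero : toricMonomial A 0 = 1 := rfl

lemma toricMonomial_add (v w : Fin n →₀ ℕ) :
    toricMonomial A (v + w) = toricMonomial A v * toricMonomial A w := by
  rw [toricMonomial, toricMonomial, toricMonomial, ← map_mul, MvPolynomial.monomial_mul, one_mul]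

lemma expDegree_zero : expDegree A 0 = 0 := by
  ext i; simp [expDegree, Matrix.mulVec, dotProduct]

lemma expDegree_add (v w : Fin n →₀ ℕ) :
    expDegree A (v + w) = expDegree A v + expDegree A w := by
  rw [expDegree, expDegree, expDegree, ← Matrix.mulVec_add]
  congr 1

lemma expDegree_single (j : Fin n) : expDegree A (Finsupp.single j 1) = col A j := by
  ext i
  simp [expDegree, Matrix.mulVec, dotProduct, col, Finsupp.single_apply]

/-- Monomials of the same degree agree in `S_A`. -/
lemma toricMonomial_eq_of_expDegree_eq {v w : Fin n →₀ ℕ} (h : expDegree A v = expDegree A w) :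
    toricMonomial A v = toricMonomial A w := by
  have hu : A.mulVec ((fun j => (v j : ℤ)) - fun j => (w j : ℤ)) = 0 := by
    rw [Matrix.mulVec_sub, sub_eq_zero]; exact h
  set u : Fin n → ℤ := (fun j => (v j : ℤ)) - fun j => (w j : ℤ) with hudef
  have hv : v = v ⊓ w + posPt u := by
    ext j
    simp only [Finsupp.coe_add, Pi.add_apply, Finsupp.inf_apply, posPt, hudef,
      Finsupp.equivFunOnFinite_symm_apply_apply, Pi.sub_apply]
    omega
  have hw : w = v ⊓ w + posPt (-u) := by
    ext j
    simp only [Finsupp.coe_add, Pi.add_apply, Finsupp.inf_apply, posPt, hudef,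
      Finsupp.equivFunOnFinite_symm_apply_apply, Pi.sub_apply, Pi.neg_apply]
    omega
  have hpq : toricMonomial A (posPt u) = toricMonomial A (posPt (-u)) :=
    Ideal.Quotient.eq.mpr (Ideal.subset_span ⟨u, hu, rfl⟩)
  calc toricMonomial A v = toricMonomial A (v ⊓ w + posPt u) := congrArg _ hv
    _ = toricMonomial A (v ⊓ w + posPt (-u)) := by
      rw [toricMonomial_add, hpq, ← toricMonomial_add]
    _ = toricMonomial A w := congrArg _ hw.symm

lemma mk_eq_sum_toricMonomial (p : MvPolynomial (Fin n) ℂ) :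
    Ideal.Quotient.mk (toricIdeal A) p =
      ∑ v ∈ p.support, p.coeff v • toricMonomial A v := by
  conv_lhs => rw [p.as_sum, map_sum]
  refine Finset.sum_congr rfl fun v _ => ?_
  rw [← mul_one (p.coeff v), ← smul_eq_mul, ← MvPolynomial.smul_monomial, smul_eq_mul, mul_one]
  rfl

lemma finsupp_add_single_induction {P : (Fin n →₀ ℕ) → Prop} (h0 : P 0)
    (hs : ∀ v j, P v → P (v + Finsupp.single j 1)) (v : Fin n →₀ ℕ) : P v := by
  suffices h : ∀ k, ∀ v : Fin n →₀ ℕ, v.degree = k → P v from h _ v rfl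
  intro k
  induction k with
  | zero => intro v hv; rwa [(Finsupp.degree_eq_zero_iff v).mp hv]
  | succ k ih =>
    intro v hv
    have hne : v ≠ 0 := by rintro rfl; simp at hv
    obtain ⟨j, hj⟩ := Finsupp.support_nonempty_iff.mpr hne
    have hle : Finsupp.single j 1 ≤ v := by
      rw [Finsupp.single_le_iff]; exact Nat.one_le_iff_ne_zero.mpr (Finsupp.mem_support_iff.mp hj)
    rw [← tsub_add_cancel_of_le hle]
    refine hs _ _ (ih _ ?_)
    have := congrArg Finsupp.degree (tsub_add_cancel_of_le hle)
    rw [map_add, Finsupp.degree_single] at this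
    omega

lemma exists_expDegree_of_mem_NFsg {F : Finset (Fin n)} {c : Fin d → ℤ} (hc : c ∈ NFsg A F) :
    ∃ w : Fin n →₀ ℕ, w.support ⊆ F ∧ expDegree A w = c := by
  induction hc using AddSubmonoid.closure_induction with
  | mem x hx =>
    obtain ⟨j, hj, rfl⟩ := hx
    refine ⟨Finsupp.single j 1, ?_, expDegree_single A j⟩
    exact Finsupp.support_single_subset.trans (by simpa using hj)
  | zero => exact ⟨0, by simp, expDegree_zero A⟩
  | add x y _ _ hx hy =>
    obtain ⟨v, hv, rfl⟩ := hx
    obtain ⟨w, hw, rfl⟩ := hy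
    exact ⟨v + w, Finsupp.support_add.trans (Finset.union_subset hv hw), expDegree_add A v w⟩

lemma toricMonomial_eq_mul_single {v : Fin n →₀ ℕ} {j : Fin n} (hj : j ∈ v.support) :
    toricMonomial A v = toricMonomial A (v - Finsupp.single j 1) *
      toricMonomial A (Finsupp.single j 1) := by
  rw [← toricMonomial_add, tsub_add_cancel_of_le]
  exact Finsupp.single_le_iff.mpr (Nat.one_le_iff_ne_zero.mpr (Finsupp.mem_support_iff.mp hj))

end Monomials

section Farkas

/-- **Farkas' lemma** over a linearly ordered field. -/
lemma farkas_lemma {k V ι : Type*} [Field k] [LinearOrder k] [IsStrictOrderedRing k]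
    [AddCommGroup V] [Module k V] (s : Finset ι) :
    ∀ (a : ι → V →ₗ[k] k) (b : V →ₗ[k] k), (∀ x, (∀ i ∈ s, a i x ≤ 0) → b x ≤ 0) →
      ∃ c : ι → k, (∀ i, 0 ≤ c i) ∧ b = ∑ i ∈ s, c i • a i := by
  classical
  induction s using Finset.induction_on with
  | empty =>
    intro a b h
    refine ⟨0, fun _ => le_rfl, ?_⟩
    ext x
    have h1 := h x (by simp)
    have h2 := h (-x) (by simp)
    rw [map_neg] at h2
    simp only [Finset.sum_empty, LinearMap.zero_apply]
    linarith
  | insert m s hm ih =>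
    intro a b h
    by_cases hb : ∀ x, (∀ i ∈ s, a i x ≤ 0) → b x ≤ 0
    · obtain ⟨c, hc, hbc⟩ := ih a b hb
      refine ⟨Function.update c m 0, fun i => ?_, ?_⟩
      · rcases eq_or_ne i m with rfl | hi
        · simp
        · simpa [hi] using hc i
      · rw [Finset.sum_insert hm, hbc, Function.update_self, zero_smul, zero_add]
        refine Finset.sum_congr rfl fun i hi => ?_
        rw [Function.update_of_ne (ne_of_mem_of_not_mem hi hm)]
    push Not at hb
    obtain ⟨x₀, hx₀, hbx₀⟩ := hb
    have ham : 0 < a m x₀ := by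
      by_contra hle
      refine absurd (h x₀ fun i hi => ?_) hbx₀.not_ge
      rcases Finset.mem_insert.mp hi with rfl | hi
      · exact not_lt.mp hle
      · exact hx₀ i hi
    set t := (a m x₀)⁻¹
    have ht0 : 0 < t := inv_pos.mpr ham
    have hta : t * a m x₀ = 1 := inv_mul_cancel₀ ham.ne'
    obtain ⟨c, hc, hbc⟩ := ih (fun i => a i - (t * a i x₀) • a m) (b - (t * b x₀) • a m) (by
      intro x hx
      have := h (x - (t * a m x) • x₀) (by
        intro i hi
        rcases Finset.mem_insert.mp hi with rfl | hi
        · simp only [map_sub, map_smul, smul_eq_mul]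
          refine le_of_eq ?_
          linear_combination (-(a i x)) * hta
        · have := hx i hi
          simp only [map_sub, map_smul, smul_eq_mul, LinearMap.sub_apply,
            LinearMap.smul_apply] at this ⊢
          linarith)
      simp only [map_sub, map_smul, smul_eq_mul, LinearMap.sub_apply,
            LinearMap.smul_apply] at this ⊢
      linarith)
    refine ⟨Function.update c m (t * b x₀ - ∑ i ∈ s, c i * (t * a i x₀)), fun i => ?_, ?_⟩
    · rcases eq_or_ne i m with rfl | hi
      · rw [Function.update_self, sub_nonneg]
        refine (Finset.sum_nonpos fun j hj => ?_).trans (mul_pos ht0 hbx₀).le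
        exact mul_nonpos_of_nonneg_of_nonpos (hc j)
          (mul_nonpos_of_nonneg_of_nonpos ht0.le (hx₀ j hj))
      · simpa [hi] using hc i
    · rw [Finset.sum_insert hm, Function.update_self]
      have hs : ∑ i ∈ s, Function.update c m (t * b x₀ - ∑ i ∈ s, c i * (t * a i x₀)) i • a i
          = ∑ i ∈ s, c i • a i := Finset.sum_congr rfl fun i hi => by
        rw [Function.update_of_ne (ne_of_mem_of_not_mem hi hm)]
      rw [hs]
      rw [sub_eq_iff_eq_add] at hbc
      refine hbc.trans ?_
      simp only [smul_sub, Finset.sum_sub_distrib, smul_smul, ← Finset.sum_smul]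
      module

end Farkas

section Faces

variable {d n : ℕ} (A : Matrix (Fin d) (Fin n) ℤ)

lemma exists_common_denominator {ι : Type*} [Fintype ι] (x : ι → ℚ) :
    ∃ D : ℕ, 0 < D ∧ ∃ z : ι → ℤ, ∀ i, (D : ℚ) * x i = z i := by
  classical
  refine ⟨∏ i, (x i).den, Finset.prod_pos fun i _ => (x i).pos,
    fun i => (∏ j ∈ Finset.univ.erase i, (x j).den : ℕ) * (x i).num, fun i => ?_⟩
  rw [← Finset.prod_erase_mul _ _ (Finset.mem_univ i)]
  push_cast
  rw [mul_assoc, Rat.den_mul_eq_num]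

/-- An integral supporting functional that vanishes on `F` and is positive on `a_k`, `k ∉ F`. -/
lemma exists_supporting_functional (F : Finset (Fin n))
    (hF : ∀ v w : Fin n →₀ ℕ, expDegree A v = expDegree A w → w.support ⊆ F → v.support ⊆ F)
    {k : Fin n} (hk : k ∉ F) :
    ∃ h : Fin d → ℤ, (∀ j, 0 ≤ ∑ i, h i * A i j) ∧ (∀ j ∈ F, ∑ i, h i * A i j = 0) ∧
      0 < ∑ i, h i * A i k := by
  classical
  let a : Fin n → (Fin d → ℚ) →ₗ[ℚ] ℚ := fun j => ∑ i, (A i j : ℚ) • LinearMap.proj i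
  have ha : ∀ j x, a j x = ∑ i, (A i j : ℚ) * x i := fun j x => by simp [a]
  by_cases hsep : ∀ x, (∀ i ∈ (Finset.univ : Finset (Fin n ⊕ Fin n)),
      (Sum.elim (fun j => -a j) (fun j => if j ∈ F then a j else 0) :
        Fin n ⊕ Fin n → (Fin d → ℚ) →ₗ[ℚ] ℚ) i x ≤ 0) → a k x ≤ 0
  · exfalso
    obtain ⟨c, hc, hck⟩ := farkas_lemma _ _ _ hsep
    obtain ⟨D, hD, z, hz⟩ := exists_common_denominator c
    have hz0 : ∀ i, 0 ≤ z i := fun i => by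
      have : (0 : ℚ) ≤ z i := hz i ▸ mul_nonneg (Nat.cast_nonneg D) (hc i)
      exact_mod_cast this
    let v : Fin n →₀ ℕ := Finsupp.equivFunOnFinite.symm fun j =>
      (if j = k then D else 0) + (z (Sum.inl j)).toNat
    let w : Fin n →₀ ℕ := Finsupp.equivFunOnFinite.symm fun j =>
      if j ∈ F then (z (Sum.inr j)).toNat else 0
    have hvw : expDegree A v = expDegree A w := by
      ext i
      have hi := congrArg (fun f => (D : ℚ) * f (Pi.single i 1)) hck
      simp only [Fintype.sum_sum_type, LinearMap.add_apply, LinearMap.sum_apply, Sum.elim_inl,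
        Sum.elim_inr, LinearMap.smul_apply, LinearMap.neg_apply, smul_eq_mul, mul_add,
        Finset.mul_sum, ← mul_assoc, hz, apply_ite (fun f : (Fin d → ℚ) →ₗ[ℚ] ℚ =>
          f (Pi.single i 1)), LinearMap.zero_apply, ha, Pi.single_apply, mul_ite, mul_one,
        mul_zero, Finset.sum_ite_eq', Finset.mem_univ, if_true, mul_neg,
        Finset.sum_neg_distrib] at hi
      rw [← sub_eq_iff_eq_add', sub_neg_eq_add] at hi
      simp only [expDegree, Matrix.mulVec, dotProduct, v, w,
        Finsupp.equivFunOnFinite_symm_apply_apply]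
      push_cast
      simp only [Int.toNat_of_nonneg (hz0 _), mul_add, mul_ite, mul_zero, Finset.sum_add_distrib,
        Finset.sum_ite_eq', Finset.mem_univ, if_true]
      have hi' : (D : ℤ) * A i k + ∑ j, z (Sum.inl j) * A i j =
          ∑ j, if j ∈ F then z (Sum.inr j) * A i j else 0 := by exact_mod_cast hi
      simpa only [mul_comm] using hi'
    have hkv : k ∈ v.support := by
      simp only [Finsupp.mem_support_iff, v, Finsupp.equivFunOnFinite_symm_apply_apply, if_true]
      omega
    refine hk (hF v w hvw (fun j hj => ?_) hkv)
    by_contra hjF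
    simp [w, hjF] at hj
  · push Not at hsep
    obtain ⟨x, hx, hxk⟩ := hsep
    have hx1 : ∀ j, 0 ≤ a j x := fun j => by simpa using hx (Sum.inl j) (Finset.mem_univ _)
    have hx2 : ∀ j ∈ F, a j x = 0 := fun j hj =>
      le_antisymm (by simpa [hj] using hx (Sum.inr j) (Finset.mem_univ _)) (hx1 j)
    obtain ⟨D, hD, h, hh⟩ := exists_common_denominator x
    have hD' : (0 : ℚ) < D := by exact_mod_cast hD
    have hj : ∀ j, ((∑ i, h i * A i j : ℤ) : ℚ) = D * a j x := fun j => by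
      rw [ha, Finset.mul_sum]
      push_cast
      refine Finset.sum_congr rfl fun i _ => ?_
      rw [← hh]
      ring
    refine ⟨h, fun j => ?_, fun j hjF => ?_, ?_⟩
    · have := mul_nonneg hD'.le (hx1 j)
      rw [← hj] at this
      exact_mod_cast this
    · have := hj j
      rw [hx2 j hjF, mul_zero] at this
      exact_mod_cast this
    · have := mul_pos hD' hxk
      rw [← hj] at this
      exact_mod_cast this

lemma isFace_of_support_closed (F : Finset (Fin n))
    (hF : ∀ v w : Fin n →₀ ℕ, expDegree A v = expDegree A w → w.support ⊆ F → v.support ⊆ F) :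
    isFace A F := by
  classical
  have H : ∀ k : Fin n, ∃ h : Fin d → ℤ, (∀ j, 0 ≤ ∑ i, h i * A i j) ∧
      (∀ j ∈ F, ∑ i, h i * A i j = 0) ∧ (k ∉ F → 0 < ∑ i, h i * A i k) := by
    intro k
    by_cases hk : k ∈ F
    · exact ⟨0, by simp, by simp, fun h => absurd hk h⟩
    · obtain ⟨h, h1, h2, h3⟩ := exists_supporting_functional A F hF hk
      exact ⟨h, h1, h2, fun _ => h3⟩
  choose h h0 hz hp using H
  have hsum : ∀ j, ∑ i, (∑ k, h k) i * A i j = ∑ k, ∑ i, h k i * A i j := fun j => by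
    simp only [Finset.sum_apply, Finset.sum_mul]
    exact Finset.sum_comm
  refine ⟨∑ k, h k, fun j => ?_, fun j => ⟨fun hj => ?_, fun hj => ?_⟩⟩
  · rw [hsum]
    exact Finset.sum_nonneg fun k _ => h0 k j
  · rw [hsum]
    exact Finset.sum_eq_zero fun k _ => hz k j hj
  · by_contra hjF
    rw [hsum, Finset.sum_eq_zero_iff_of_nonneg fun k _ => h0 k j] at hj
    exact (hp j hjF).ne' (hj j (Finset.mem_univ j))

end Faces

section Cosets

variable {d n : ℕ} (A : Matrix (Fin d) (Fin n) ℤ)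

/-- A quasi-degree of a shifted face ring differs from the degree of its generator by a
torsion class modulo `ℤF`. -/
lemma mk_mem_torsion_of_mem_qdegFace {F : Finset (Fin n)} {b β : Fin d → ℤ}
    (h : (fun i => -(β i : ℂ)) ∈ qdegFace A F b) :
    Submodule.Quotient.mk (b + β) ∈
      Submodule.torsion ℤ ((Fin d → ℤ) ⧸ Submodule.span ℤ (col A '' F)) := by
  classical
  set L := Submodule.span ℤ (col A '' (F : Set (Fin n)))
  set T := Submodule.torsion ℤ ((Fin d → ℤ) ⧸ L)
  rw [← Submodule.Quotient.mk_eq_zero T, ← Module.forall_dual_apply_eq_zero_iff ℤ]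
  intro f
  let f' : (Fin d → ℤ) →ₗ[ℤ] ℤ := f ∘ₗ T.mkQ ∘ₗ L.mkQ
  change f' (b + β) = 0
  have hL : ∀ v ∈ L, f' v = 0 := fun v hv => by
    have : L.mkQ v = 0 := (Submodule.Quotient.mk_eq_zero L).mpr hv
    simp [f', this]
  have hNF : ∀ v ∈ NFsg A F, v ∈ L := fun v hv => by
    have : NFsg A F ≤ L.toAddSubmonoid := AddSubmonoid.closure_le.mpr Submodule.subset_span
    exact this hv
  have hf : ∀ v : Fin d → ℤ, f' v = ∑ i, v i * f' (Pi.single i 1) := fun v => by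
    conv_lhs => rw [pi_eq_sum_univ' v, map_sum]
    simp only [map_smul, smul_eq_mul]
  have hz := h (∑ i, MvPolynomial.C (f' (Pi.single i 1) : ℂ) *
    (MvPolynomial.X i - MvPolynomial.C (b i : ℂ))) (by
      rintro _ ⟨v, hv, rfl⟩
      have := hL v (hNF v hv)
      rw [hf] at this
      simp only [map_sum, map_mul, map_sub, MvPolynomial.eval_C, MvPolynomial.eval_X]
      have h2 := congrArg (fun z : ℤ => -(z : ℂ)) this
      push_cast at h2
      rw [neg_zero, ← Finset.sum_neg_distrib] at h2
      rw [← h2]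
      refine Finset.sum_congr rfl fun i _ => ?_
      simp only [Pi.sub_apply]
      push_cast
      ring)
  have : ((f' (b + β) : ℤ) : ℂ) = 0 := by
    rw [hf, ← neg_eq_zero, ← hz]
    simp only [map_sum, map_mul, map_sub, MvPolynomial.eval_C, MvPolynomial.eval_X]
    push_cast
    rw [← Finset.sum_neg_distrib]
    refine Finset.sum_congr rfl fun i _ => ?_
    simp only [Pi.add_apply]
    push_cast
    ring
  exact_mod_cast this

lemma finite_torsion_quotient (L : Submodule ℤ (Fin d → ℤ)) :
    (Submodule.torsion ℤ ((Fin d → ℤ) ⧸ L) : Set ((Fin d → ℤ) ⧸ L)).Finite := by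
  have : Finite (Submodule.torsion ℤ ((Fin d → ℤ) ⧸ L)) :=
    Module.finite_of_fg_torsion _ (Submodule.torsion_isTorsion)
  exact Set.toFinite _

lemma exists_sub_of_mem_span {F : Finset (Fin n)} {v : Fin d → ℤ}
    (hv : v ∈ Submodule.span ℤ (col A '' F)) :
    ∃ p ∈ NFsg A F, ∃ q ∈ NFsg A F, v = p - q := by
  rw [← Submodule.mem_toAddSubgroup, Submodule.span_int_eq_addSubgroupClosure] at hv
  induction hv using AddSubgroup.closure_induction with
  | mem x hx => exact ⟨x, AddSubmonoid.subset_closure hx, 0, zero_mem _, by simp⟩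
  | zero => exact ⟨0, zero_mem _, 0, zero_mem _, by simp⟩
  | add x y _ _ hx hy =>
    obtain ⟨p, hp, q, hq, rfl⟩ := hx
    obtain ⟨p', hp', q', hq', rfl⟩ := hy
    exact ⟨p + p', add_mem hp hp', q + q', add_mem hq hq', by abel⟩
  | neg x _ hx =>
    obtain ⟨p, hp, q, hq, rfl⟩ := hx
    exact ⟨q, hq, p, hp, by abel⟩

/-- Finitely many translates of `-ℕF` by elements of one coset of `ℤF` have a common point. -/
lemma exists_common_degree {F : Finset (Fin n)} {ι : Type*} (T : Finset ι) (b : ι → Fin d → ℤ)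
    (b₀ : Fin d → ℤ) (hb : ∀ s ∈ T, b s - b₀ ∈ Submodule.span ℤ (col A '' F)) :
    ∃ c, ∀ s ∈ T, b s - c ∈ NFsg A F := by
  classical
  have H : ∀ s : T, ∃ p ∈ NFsg A F, ∃ q ∈ NFsg A F, b s - b₀ = p - q := fun s =>
    exists_sub_of_mem_span A (hb s s.2)
  choose p hp q hq hpq using H
  refine ⟨b₀ - ∑ t, q t, fun s hs => ?_⟩
  have hsum := Finset.add_sum_erase Finset.univ q (Finset.mem_univ ⟨s, hs⟩)
  have : b s - (b₀ - ∑ t, q t) = p ⟨s, hs⟩ + ∑ t ∈ Finset.univ.erase ⟨s, hs⟩, q t := by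
    rw [← hsum, sub_sub_eq_add_sub, add_sub_right_comm, hpq ⟨s, hs⟩]
    abel
  rw [this]
  exact add_mem (hp _) (sum_mem fun t _ => hq t)

end Cosets

section ColonIdeals

variable {d n : ℕ} (A : Matrix (Fin d) (Fin n) ℤ) {M : Type*} [AddCommGroup M]
  [Module (SAring A) M]

/-- The ideal of elements multiplying `m` into `N`. -/
noncomputable def colonIdeal (N : Submodule (SAring A) M) (m : M) : Ideal (SAring A) :=
  N.comap (LinearMap.toSpanSingleton (SAring A) M m)

variable {A}

lemma mem_colonIdeal {N : Submodule (SAring A) M} {m : M} {r : SAring A} :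
    r ∈ colonIdeal A N m ↔ r • m ∈ N := Iff.rfl

/-- Every member of `x` eventually lies in a filtration that strictly grows inside the submodule
generated by the first missing member. -/
lemma exists_mem_of_growth {x : ℕ → M} {N : ℕ → Submodule (SAring A) M} (hN : Monotone N)
    (hgrow : ∀ s k, (∀ i < k, x i ∈ N s) → x k ∉ N s →
      ∃ r : SAring A, r • x k ∈ N (s + 1) ∧ r • x k ∉ N s) (k : ℕ) : ∃ s, x k ∈ N s := by
  induction k using Nat.strong_induction_on with
  | _ k ih =>
    by_contra! hk
    choose! t ht using ih
    let s₀ := (Finset.range k).sup t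
    have hs₀ : ∀ s, ∀ i < k, x i ∈ N (s₀ + s) := fun s i hi =>
      hN ((Finset.le_sup (Finset.mem_range.mpr hi)).trans (Nat.le_add_right _ _)) (ht i hi)
    let J : ℕ →o Ideal (SAring A) :=
      ⟨fun s => colonIdeal A (N (s₀ + s)) (x k), fun s s' h r hr => hN (by omega) hr⟩
    obtain ⟨s, hs⟩ := monotone_stabilizes_iff_noetherian.mpr
      (inferInstance : IsNoetherian (SAring A) (SAring A)) J
    obtain ⟨r, hr, hr'⟩ := hgrow (s₀ + s) k (hs₀ s) (hk _)
    have hmem : r ∈ J (s + 1) := hr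
    rw [← hs (s + 1) (Nat.le_succ s)] at hmem
    exact hr' hmem

end ColonIdeals

section GradedModules

open DirectSum

variable {d n : ℕ} (A : Matrix (Fin d) (Fin n) ℤ) {M : Type*} [AddCommGroup M] [Module ℂ M]
  [Module (SAring A) M] (g : (Fin d → ℤ) → Submodule ℂ M)

/-- The variables `∂_j` lower degrees by `a_j`. -/
def VariablesShift : Prop :=
  ∀ (j : Fin n) (b : Fin d → ℤ), ∀ m ∈ g b,
    (Ideal.Quotient.mk (toricIdeal A) (MvPolynomial.X j)) • m ∈ g (b - col A j)

/-- The submodule `N` contains the homogeneous components of its elements. -/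
def IsGradedSubmodule [Decomposition g] (N : Submodule (SAring A) M) : Prop :=
  ∀ m ∈ N, ∀ b, (decompose g m b : M) ∈ N

/-- `N'` is obtained from `N` by adjoining a homogeneous generator `m` of degree `b` such that
`N' / N` is the face ring of `F` generated by the class of `m`. -/
structure IsFaceStep (N N' : Submodule (SAring A) M) (F : Finset (Fin n)) (b : Fin d → ℤ)
    (m : M) : Prop where
  face : isFace A F
  mem_degree : m ∈ g b
  sup_eq : N' = N ⊔ Submodule.span (SAring A) {m}
  smul_mem_iff : ∀ r : SAring A, r • m ∈ N ↔ r ∈ facePrime A F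
  monomial_smul_notMem : ∀ w : Fin n →₀ ℕ, w.support ⊆ F → toricMonomial A w • m ∉ N

variable {A g}

lemma toricMonomial_smul_mem (hg : VariablesShift A g) {b : Fin d → ℤ} {m : M} (hm : m ∈ g b)
    (v : Fin n →₀ ℕ) : toricMonomial A v • m ∈ g (b - expDegree A v) := by
  induction v using finsupp_add_single_induction with
  | h0 => rwa [toricMonomial_zero, one_smul, expDegree_zero, sub_zero]
  | hs v j ih =>
    rw [add_comm v, toricMonomial_add, mul_smul, expDegree_add, expDegree_single, add_comm,
      ← sub_sub]
    exact hg j _ _ ih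

lemma IsGradedSubmodule.bot [Decomposition g] : IsGradedSubmodule A g ⊥ := by
  intro m hm b
  rw [(Submodule.mem_bot _).mp hm, decompose_zero]
  simp

variable [IsScalarTower ℂ (SAring A) M]

lemma decompose_mk_smul [Decomposition g] (hg : VariablesShift A g) {b : Fin d → ℤ} {m : M}
    (hm : m ∈ g b) (p : MvPolynomial (Fin n) ℂ) (c : Fin d → ℤ) :
    (decompose g (Ideal.Quotient.mk (toricIdeal A) p • m) c : M) =
      (∑ v ∈ p.support with b - expDegree A v = c, p.coeff v • toricMonomial A v) • m := by
  rw [mk_eq_sum_toricMonomial, Finset.sum_smul, decompose_sum, DFinsupp.finsetSum_apply,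
    AddSubmonoidClass.coe_finsetSum, Finset.sum_smul, Finset.sum_filter]
  refine Finset.sum_congr rfl fun v _ => ?_
  have hmem : (p.coeff v • toricMonomial A v) • m ∈ g (b - expDegree A v) := by
    rw [smul_assoc]
    exact (g _).smul_mem _ (toricMonomial_smul_mem hg hm v)
  split_ifs with h
  · subst h
    exact decompose_of_mem_same g hmem
  · exact decompose_of_mem_ne g hmem h

lemma IsGradedSubmodule.sup_span [Decomposition g] (hg : VariablesShift A g)
    {N : Submodule (SAring A) M} (hN : IsGradedSubmodule A g N) {b : Fin d → ℤ} {m : M}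
    (hm : m ∈ g b) : IsGradedSubmodule A g (N ⊔ Submodule.span (SAring A) {m}) := by
  intro x hx c
  obtain ⟨y, hy, z, hz, rfl⟩ := Submodule.mem_sup.mp hx
  obtain ⟨r, rfl⟩ := Submodule.mem_span_singleton.mp hz
  obtain ⟨p, rfl⟩ := Ideal.Quotient.mk_surjective r
  rw [decompose_add, DirectSum.add_apply, Submodule.coe_add, decompose_mk_smul hg hm]
  exact add_mem (Submodule.mem_sup_left (hN y hy c))
    (Submodule.mem_sup_right (Submodule.smul_mem _ _ (Submodule.mem_span_singleton_self m)))

/-- A homogeneous element whose monomial multiples outside `N` are exactly those by monomials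
supported on `F` generates a shifted face ring modulo `N`. -/
lemma smul_mem_iff_mem_facePrime [Decomposition g] (hg : VariablesShift A g)
    {N : Submodule (SAring A) M} (hN : IsGradedSubmodule A g N) {b : Fin d → ℤ} {m : M}
    (hm : m ∈ g b) {F : Finset (Fin n)}
    (hF : ∀ j ∉ F, toricMonomial A (Finsupp.single j 1) • m ∈ N)
    (hw : ∀ w : Fin n →₀ ℕ, w.support ⊆ F → toricMonomial A w • m ∉ N) (r : SAring A) :
    r • m ∈ N ↔ r ∈ facePrime A F := by
  classical
  have hle : facePrime A F ≤ colonIdeal A N m := by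
    refine Ideal.span_le.mpr ?_
    rintro _ ⟨j, hj, rfl⟩
    exact hF j hj
  refine ⟨fun hr => ?_, fun hr => hle hr⟩
  have hmono : ∀ v : Fin n →₀ ℕ, ¬ v.support ⊆ F → toricMonomial A v ∈ facePrime A F := by
    intro v hv
    obtain ⟨j, hjv, hjF⟩ := Finset.not_subset.mp hv
    rw [toricMonomial_eq_mul_single A hjv]
    exact Ideal.mul_mem_left _ _ (Ideal.subset_span ⟨j, hjF, rfl⟩)
  obtain ⟨p, rfl⟩ := Ideal.Quotient.mk_surjective r
  rw [mk_eq_sum_toricMonomial,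
    ← Finset.sum_fiberwise_of_maps_to (fun v hv => Finset.mem_image_of_mem
      (fun v => b - expDegree A v) hv)]
  refine sum_mem fun c _ => ?_
  have hc := hN _ hr c
  rw [decompose_mk_smul hg hm] at hc
  by_cases hex : ∃ w : Fin n →₀ ℕ, b - expDegree A w = c ∧ w.support ⊆ F
  · obtain ⟨w, rfl, hwF⟩ := hex
    have hsum : ∑ v ∈ p.support with b - expDegree A v = b - expDegree A w,
        p.coeff v • toricMonomial A v =
        (∑ v ∈ p.support with b - expDegree A v = b - expDegree A w, p.coeff v) •
          toricMonomial A w := by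
      rw [Finset.sum_smul]
      refine Finset.sum_congr rfl fun v hv => ?_
      rw [toricMonomial_eq_of_expDegree_eq A (sub_right_injective (Finset.mem_filter.mp hv).2)]
    rw [hsum] at hc ⊢
    by_cases h0 : ∑ v ∈ p.support with b - expDegree A v = b - expDegree A w, p.coeff v = 0
    · rw [h0, zero_smul]
      exact zero_mem _
    · rw [smul_assoc] at hc
      refine absurd ?_ (hw w hwF)
      have := (N.restrictScalars ℂ).smul_mem (∑ v ∈ p.support with
        b - expDegree A v = b - expDegree A w, p.coeff v)⁻¹ hc
      rwa [inv_smul_smul₀ h0] at this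
  · refine sum_mem fun v hv => ?_
    exact Submodule.smul_of_tower_mem _ _ (hmono v fun h => hex ⟨v, (Finset.mem_filter.mp hv).2, h⟩)

/-- A homogeneous element outside a graded submodule `N` has a monomial multiple that generates a
shifted face ring modulo `N`. -/
lemma exists_isFaceStep [Decomposition g] (hg : VariablesShift A g)
    {N : Submodule (SAring A) M} (hN : IsGradedSubmodule A g N) {b : Fin d → ℤ} {x : M}
    (hx : x ∈ g b) (hxN : x ∉ N) :
    ∃ (u : Fin n →₀ ℕ) (F : Finset (Fin n)), IsFaceStep A g N
      (N ⊔ Submodule.span (SAring A) {toricMonomial A u • x}) F (b - expDegree A u)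
      (toricMonomial A u • x) := by
  classical
  obtain ⟨_, ⟨u, huN, rfl⟩, hmax⟩ := set_has_maximal_iff_noetherian.mpr
    (inferInstance : IsNoetherian (SAring A) (SAring A))
    {I | ∃ u, toricMonomial A u • x ∉ N ∧ colonIdeal A N (toricMonomial A u • x) = I}
    ⟨_, 0, by rwa [toricMonomial_zero, one_smul], rfl⟩
  set y := toricMonomial A u • x with hy
  have hyg := toricMonomial_smul_mem hg hx u
  rw [← hy] at hyg
  have hcolon : ∀ v, toricMonomial A v • y ∉ N →
      colonIdeal A N (toricMonomial A v • y) = colonIdeal A N y := by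
    intro v hv
    have hle : colonIdeal A N y ≤ colonIdeal A N (toricMonomial A v • y) := fun r hr => by
      rw [mem_colonIdeal, smul_comm]
      exact N.smul_mem _ hr
    have hvu : toricMonomial A (v + u) • x = toricMonomial A v • y := by
      rw [toricMonomial_add, mul_smul]
    refine (hle.eq_of_not_lt ?_).symm
    exact hmax _ ⟨v + u, by rwa [hvu], by rw [hvu]⟩
  let F : Finset (Fin n) := {j | toricMonomial A (Finsupp.single j 1) • y ∉ N}
  have hF : ∀ j ∉ F, toricMonomial A (Finsupp.single j 1) • y ∈ N := fun j hj => by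
    simpa [F] using hj
  have hw : ∀ w : Fin n →₀ ℕ, w.support ⊆ F → toricMonomial A w • y ∉ N := by
    intro w
    induction w using finsupp_add_single_induction with
    | h0 => intro _; rwa [toricMonomial_zero, one_smul]
    | hs v j ih =>
      intro hsupp
      have hsub : v.support ⊆ F := fun i hi => hsupp (by
        rw [Finsupp.mem_support_iff] at hi ⊢
        simp only [Finsupp.add_apply]
        omega)
      have hjF : j ∈ F := hsupp (by simp)
      have hj : toricMonomial A (Finsupp.single j 1) ∉ colonIdeal A N y := by
        simpa [F, mem_colonIdeal] using hjF
      rw [← hcolon v (ih hsub), mem_colonIdeal, ← mul_smul, ← toricMonomial_add, add_comm] at hj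
      exact hj
  refine ⟨u, F, isFace_of_support_closed A F fun v w hvw hwF j hjv => ?_, hyg, rfl,
    smul_mem_iff_mem_facePrime hg hN hyg hF hw, hw⟩
  by_contra hjF
  refine hw w hwF ?_
  rw [← toricMonomial_eq_of_expDegree_eq A hvw, toricMonomial_eq_mul_single A hjv, mul_smul]
  exact N.smul_mem _ (hF j hjF)

end GradedModules

/-- A graded vector space with finite-dimensional components is spanned by a sequence of
homogeneous elements. -/
lemma exists_homogeneous_sequence {d : ℕ} {M : Type*} [AddCommGroup M] [Module ℂ M]
    {g : (Fin d → ℤ) → Submodule ℂ M} (hfin : ∀ b, Module.Finite ℂ (g b)) :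
    ∃ (x : ℕ → M) (deg : ℕ → Fin d → ℤ), (∀ k, x k ∈ g (deg k)) ∧
      ∀ b, g b ≤ Submodule.span ℂ (Set.range x) := by
  obtain ⟨f, hf⟩ := exists_surjective_nat
    (Option (Σ b : Fin d → ℤ, Fin (Module.finrank ℂ (g b))))
  refine ⟨fun k => (f k).elim 0 fun i => (Module.finBasis ℂ (g i.1) i.2 : M),
    fun k => (f k).elim 0 Sigma.fst, fun k => ?_, fun b m hm => ?_⟩
  · dsimp only
    cases f k with
    | none => exact zero_mem _
    | some i => exact (Module.finBasis ℂ (g i.1) i.2).2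
  · have hrepr := congrArg (Submodule.subtype _) ((Module.finBasis ℂ (g b)).sum_repr ⟨m, hm⟩)
    rw [map_sum] at hrepr
    change _ = m at hrepr
    rw [← hrepr]
    refine sum_mem fun i _ => ?_
    rw [map_smul]
    obtain ⟨k, hk⟩ := hf (some ⟨b, i⟩)
    refine Submodule.smul_mem _ _ (Submodule.subset_span ⟨k, ?_⟩)
    simp [hk]

section Filtrations

open DirectSum

variable {d n : ℕ} {A : Matrix (Fin d) (Fin n) ℤ} {M : Type*} [AddCommGroup M] [Module ℂ M]
  [Module (SAring A) M] {g : (Fin d → ℤ) → Submodule ℂ M} [IsScalarTower ℂ (SAring A) M]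

/-- A filtration strictly increases in a fixed degree at most as often as the dimension. -/
lemma card_le_of_jumps {V : Submodule ℂ M} {C : ℕ} (hV : Module.rank ℂ V ≤ C)
    {N : ℕ → Submodule (SAring A) M} (hN : Monotone N) (T : Finset ℕ) (e : T → M)
    (heV : ∀ s, e s ∈ V) (he : ∀ s : T, e s ∈ N (s + 1)) (he' : ∀ s : T, e s ∉ N s) :
    T.card ≤ C := by
  classical
  have hli : LinearIndependent ℂ e := by
    rw [linearIndependent_iff']
    intro S f hf
    by_contra! hne
    obtain ⟨i, hi, hfi⟩ := hne
    obtain ⟨t, ht, hmax⟩ := Finset.exists_max_image (S.filter fun s => f s ≠ 0) id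
      ⟨i, Finset.mem_filter.mpr ⟨hi, hfi⟩⟩
    obtain ⟨htS, hft⟩ := Finset.mem_filter.mp ht
    rw [← Finset.add_sum_erase S _ htS, add_eq_zero_iff_eq_neg] at hf
    refine he' t ?_
    have hmem : f t • e t ∈ N t := by
      rw [hf]
      refine neg_mem (sum_mem fun s hs => ?_)
      obtain ⟨hst, hsS⟩ := Finset.mem_erase.mp hs
      by_cases hfs : f s = 0
      · rw [hfs, zero_smul]; exact zero_mem _
      · have hlt : s < t := lt_of_le_of_ne (hmax s (Finset.mem_filter.mpr ⟨hsS, hfs⟩)) hst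
        exact Submodule.smul_of_tower_mem _ _ (hN (Nat.succ_le_of_lt hlt) (he s))
    have := Submodule.smul_of_tower_mem (N t) (f t)⁻¹ hmem
    rwa [inv_smul_smul₀ hft] at this
  have hli' : LinearIndependent ℂ fun s => (⟨e s, heV s⟩ : V) :=
    LinearIndependent.of_comp V.subtype hli
  have h := hli'.cardinal_lift_le_rank.trans (Cardinal.lift_le.mpr hV)
  simpa using h

/-- In a filtration of a module with bounded Hilbert function, only finitely many shifts of a
given face ring have a given quasi-degree. -/
lemma finite_setOf_mem_qdegFace (hg : VariablesShift A g) {C : ℕ}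
    (hC : ∀ b, Module.rank ℂ (g b) ≤ C) {N : ℕ → Submodule (SAring A) M} (hN : Monotone N)
    {F : Finset (Fin n)} {b : ℕ → Fin d → ℤ} {m : ℕ → M} {β : Fin d → ℤ} {S : Set ℕ}
    (hS : ∀ s ∈ S, IsFaceStep A g (N s) (N (s + 1)) F (b s) (m s))
    (hβ : ∀ s ∈ S, (fun i => -(β i : ℂ)) ∈ qdegFace A F (b s)) : S.Finite := by
  classical
  refine Set.Finite.of_finite_fibers
    (fun s => (Submodule.Quotient.mk (b s + β) :
      (Fin d → ℤ) ⧸ Submodule.span ℤ (col A '' (F : Set (Fin n)))))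
    ((finite_torsion_quotient _).subset ?_) fun q _ => ?_
  · rintro _ ⟨s, hs, rfl⟩
    exact mk_mem_torsion_of_mem_qdegFace A (hβ s hs)
  · by_contra hinf
    obtain ⟨T, hTS, hT⟩ := Set.Infinite.exists_subset_card_eq hinf (C + 1)
    have hTne : T.Nonempty := Finset.card_pos.mp (by omega)
    obtain ⟨s₀, hs₀⟩ := hTne
    obtain ⟨c, hc⟩ := exists_common_degree A (F := F) T b (b s₀) fun s hs => by
      have := (hTS hs).2.trans (hTS hs₀).2.symm
      simpa using (Submodule.Quotient.eq _).mp this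
    choose w hwF hw using fun s : T => exists_expDegree_of_mem_NFsg A (hc s s.2)
    have hstep : ∀ s : T, IsFaceStep A g (N s) (N (s + 1)) F (b s) (m s) := fun s =>
      hS s (hTS s.2).1
    have := card_le_of_jumps (hC c) hN T (fun s => toricMonomial A (w s) • m s)
      (fun s => by
        have := toricMonomial_smul_mem hg (hstep s).mem_degree (w s)
        rwa [hw, sub_sub_cancel] at this)
      (fun s => by
        rw [(hstep s).sup_eq]
        exact Submodule.smul_mem _ _
          (Submodule.mem_sup_right (Submodule.mem_span_singleton_self _)))
      (fun s => (hstep s).monomial_smul_notMem _ (hwF s))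
    omega

/-- One step of the filtration: a shifted face ring is adjoined inside the submodule generated by
the first member of the sequence `x` that is still missing. -/
lemma exists_next_submodule [Decomposition g] (hg : VariablesShift A g) {x : ℕ → M}
    {deg : ℕ → Fin d → ℤ} (hx : ∀ k, x k ∈ g (deg k)) {N : Submodule (SAring A) M}
    (hN : IsGradedSubmodule A g N) :
    ∃ (N' : Submodule (SAring A) M) (F : Finset (Fin n)) (b : Fin d → ℤ) (m : M),
      IsGradedSubmodule A g N' ∧ N ≤ N' ∧ (N' = N ∨ IsFaceStep A g N N' F b m) ∧
      ∀ k, (∀ i < k, x i ∈ N) → x k ∉ N → ∃ r : SAring A, r • x k ∈ N' ∧ r • x k ∉ N := by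
  classical
  by_cases hall : ∃ k, x k ∉ N
  · obtain ⟨u, F, hstep⟩ := exists_isFaceStep hg hN (hx (Nat.find hall)) (Nat.find_spec hall)
    refine ⟨_, F, _, _, hN.sup_span hg hstep.mem_degree, le_sup_left, Or.inr hstep,
      fun k hk hkN => ?_⟩
    obtain rfl : k = Nat.find hall := le_antisymm
      (not_lt.mp fun hlt => Nat.find_spec hall (hk _ hlt)) (Nat.find_min' hall hkN)
    refine ⟨toricMonomial A u,
      Submodule.mem_sup_right (Submodule.mem_span_singleton_self _), ?_⟩
    simpa [toricMonomial_zero] using hstep.monomial_smul_notMem 0 (by simp)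
  · push Not at hall
    exact ⟨N, ∅, 0, 0, hN, le_rfl, Or.inl rfl, fun k _ hk => absurd (hall k) hk⟩

end Filtrations

/-!
STATEMENT 6: Let `M` be a `ℤ^d`-graded module over `S_A = ℂ[ℕA]` such that
`b ↦ dim_ℂ M_b` is bounded. Then `M` is weakly toric: it has an exhaustive
increasing filtration `⊥ = M_0 ⊆ M_1 ⊆ ⋯` by graded submodules whose successive
(nontrivial) quotients are shifted face rings `S_F(b_s)` (cyclic with a homogeneous
generator annihilated exactly by the face prime), and for every `β ∈ ℤ^d` only
finitely many quotients have `-β` among their quasi-degrees.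
-/
theorem bounded_graded_module_weakly_toric {d n : ℕ} (A : Matrix (Fin d) (Fin n) ℤ)
    (hZA : Submodule.span ℤ (Set.range (col A)) = ⊤)
    (hpos : ∀ v ∈ AddSubmonoid.closure (Set.range (col A)),
      -v ∈ AddSubmonoid.closure (Set.range (col A)) → v = 0)
    (M : Type) [AddCommGroup M] [Module ℂ M] [Module (SAring A) M]
    [IsScalarTower ℂ (SAring A) M]
    (g : (Fin d → ℤ) → Submodule ℂ M)
    (hint : DirectSum.IsInternal g)
    (hcompat : ∀ (j : Fin n) (b : Fin d → ℤ), ∀ m ∈ g b,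
      (Ideal.Quotient.mk (toricIdeal A) (MvPolynomial.X j)) • m ∈ g (b - col A j))
    -- the dimensions of the graded pieces are bounded:
    (hbdd : ∃ C : ℕ, ∀ b : Fin d → ℤ, Module.rank ℂ ↥(g b) ≤ C) :
    ∃ (N : ℕ → Submodule (SAring A) M) (Fc : ℕ → Finset (Fin n))
      (bc : ℕ → Fin d → ℤ) (mg : ℕ → M),
      N 0 = ⊥ ∧ Monotone N ∧ (⨆ s, N s) = ⊤ ∧
      (∀ s : ℕ, N (s + 1) = N s ∨
        (isFace A (Fc s) ∧ mg s ∈ g (bc s) ∧ mg s ∈ N (s + 1) ∧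
          N (s + 1) = N s ⊔ Submodule.span (SAring A) {mg s} ∧
          ∀ r : SAring A, r • mg s ∈ N s ↔ r ∈ facePrime A (Fc s))) ∧
      ∀ β : Fin d → ℤ,
        {s : ℕ | N (s + 1) ≠ N s ∧
          (fun i => -(β i : ℂ)) ∈ qdegFace A (Fc s) (bc s)}.Finite := by
  classical
  obtain ⟨C, hC⟩ := hbdd
  let _ := hint.chooseDecomposition
  have hfin : ∀ b, Module.Finite ℂ (g b) := fun b =>
    Module.rank_lt_aleph0_iff.mp ((hC b).trans_lt Cardinal.natCast_lt_aleph0)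
  obtain ⟨x, deg, hx, hspan⟩ := exists_homogeneous_sequence hfin
  choose nextN F b m hgr hle hstep hgrow using
    fun N : {N : Submodule (SAring A) M // IsGradedSubmodule A g N} =>
      exists_next_submodule hcompat hx N.2
  let σ : ℕ → {N : Submodule (SAring A) M // IsGradedSubmodule A g N} := fun s =>
    Nat.rec ⟨⊥, IsGradedSubmodule.bot⟩ (fun _ N => ⟨nextN N, hgr N⟩) s
  have hmono : Monotone fun s => (σ s).1 := monotone_nat_of_le_succ fun s => hle (σ s)
  refine ⟨fun s => (σ s).1, fun s => F (σ s), fun s => b (σ s), fun s => m (σ s), rfl, hmono,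
    ?_, fun s => ?_, fun β => ?_⟩
  · have hxN : ∀ k, x k ∈ ⨆ s, (σ s).1 := fun k => by
      obtain ⟨s, hs⟩ := exists_mem_of_growth hmono (fun s => hgrow (σ s)) k
      exact le_iSup (fun s => (σ s).1) s hs
    have hg : ∀ c, g c ≤ (⨆ s, (σ s).1).restrictScalars ℂ := fun c =>
      (hspan c).trans (Submodule.span_le.mpr (by rintro _ ⟨k, rfl⟩; exact hxN k))
    have htop := (hint.submodule_iSup_eq_top).symm.le.trans (iSup_le hg)
    exact eq_top_iff.mpr fun y _ => htop Submodule.mem_top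
  · refine (hstep (σ s)).imp id fun h => ⟨h.face, h.mem_degree, ?_, h.sup_eq, h.smul_mem_iff⟩
    change _ ∈ nextN (σ s)
    rw [h.sup_eq]
    exact Submodule.mem_sup_right (Submodule.mem_span_singleton_self _)
  · refine (Set.finite_iUnion fun G : Finset (Fin n) => finite_setOf_mem_qdegFace hcompat hC hmono
      (F := G) (b := fun s => b (σ s)) (m := fun s => m (σ s)) (β := β)
      (S := {s | (σ (s + 1)).1 ≠ (σ s).1 ∧ F (σ s) = G ∧
        (fun i => -(β i : ℂ)) ∈ qdegFace A (F (σ s)) (b (σ s))}) ?_ ?_).subset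
      fun s hs => Set.mem_iUnion.mpr ⟨F (σ s), hs.1, rfl, hs.2⟩
    · rintro s ⟨hne, rfl, -⟩
      exact (hstep (σ s)).resolve_left hne
    · rintro s ⟨-, rfl, hq⟩
      exact hq
end

section
/- In the one-variable Weyl algebra localized at t (i.e. C⟨t, t^{-1}, ∂⟩ with ∂t - t∂ = 1), consider the cyclic left module M(β) = D/D·(∂t + β) for β ∈ C. Left multiplication by ∂t on M(β) is bijective if and only if β ∉ Z; equivalently, the two-term Koszul complex of the endomorphism induced by ∂t on M(β) is exact if and only if β ∉ Z, and if β ∈ Z both its homology groups are one-dimensional over C. -/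
/-!
STATEMENT 9: In the ring `D = ℂ⟨t, t⁻¹, ∂⟩` of differential operators on `ℂ^*`
(`∂t - t∂ = 1`), consider `M(β) = D/D·(∂t + β)` for `β ∈ ℂ`. Left multiplication by
`∂t` on `M(β)` is bijective if and only if `β ∉ ℤ`; and if `β ∈ ℤ`, both its kernel
and cokernel (the two homology groups of the two-term Koszul complex of this
endomorphism) are one-dimensional over `ℂ`.
-/

/-- Generators `t`, `t⁻¹`, `∂` of the localized Weyl algebra. -/
inductive CGen : Type
  | t : CGen
  | tinv : CGen
  | dd : CGen

/-- Relations: `t·t⁻¹ = 1 = t⁻¹·t` and `∂t = t∂ + 1`. -/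
inductive CRel : FreeAlgebra ℂ CGen → FreeAlgebra ℂ CGen → Prop
  | tt : CRel (FreeAlgebra.ι ℂ CGen.t * FreeAlgebra.ι ℂ CGen.tinv) 1
  | tt' : CRel (FreeAlgebra.ι ℂ CGen.tinv * FreeAlgebra.ι ℂ CGen.t) 1
  | dt : CRel (FreeAlgebra.ι ℂ CGen.dd * FreeAlgebra.ι ℂ CGen.t)
      (FreeAlgebra.ι ℂ CGen.t * FreeAlgebra.ι ℂ CGen.dd + 1)

/-- The ring `D = ℂ⟨t, t⁻¹, ∂⟩` of differential operators on the torus `ℂ^*`. -/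
abbrev DTorus := RingQuot CRel

noncomputable def Ct : DTorus := RingQuot.mkAlgHom ℂ CRel (FreeAlgebra.ι ℂ CGen.t)
noncomputable def Cd : DTorus := RingQuot.mkAlgHom ℂ CRel (FreeAlgebra.ι ℂ CGen.dd)

/-- The left ideal `D·(∂t + β)`. -/
noncomputable def twistIdeal (β : ℂ) : Submodule DTorus DTorus :=
  Submodule.span DTorus {Cd * Ct + algebraMap ℂ DTorus β}

/-- The twisted module `M(β) = D/D(∂t + β)`. -/
noncomputable abbrev Mtw (β : ℂ) := DTorus ⧸ twistIdeal β

/-- Left multiplication by `∂t` descends to a `ℂ`-linear endomorphism of `M(β)`. -/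
noncomputable def thetaMap (β : ℂ) : Mtw β →ₗ[ℂ] Mtw β :=
  Submodule.mapQ ((twistIdeal β).restrictScalars ℂ) ((twistIdeal β).restrictScalars ℂ)
    (LinearMap.mulLeft ℂ (Cd * Ct))
    (by
      intro x hx
      simp only [Submodule.restrictScalars_mem] at hx
      rcases Submodule.mem_span_singleton.mp hx with ⟨q, rfl⟩
      refine Submodule.mem_comap.mpr ?_
      simp only [Submodule.restrictScalars_mem, LinearMap.mulLeft_apply, smul_eq_mul]
      exact Submodule.mem_span_singleton.mpr
        ⟨Cd * Ct * q, by rw [smul_eq_mul, mul_assoc]⟩)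

/-- The inverse of `t` in `D`. -/
noncomputable def Ctinv : DTorus := RingQuot.mkAlgHom ℂ CRel (FreeAlgebra.ι ℂ CGen.tinv)

lemma Ct_mul_Ctinv : Ct * Ctinv = 1 := by
  simpa [Ct, Ctinv] using RingQuot.mkAlgHom_rel ℂ CRel.tt

lemma Ctinv_mul_Ct : Ctinv * Ct = 1 := by
  simpa [Ct, Ctinv] using RingQuot.mkAlgHom_rel ℂ CRel.tt'

lemma Cd_mul_Ct : Cd * Ct = Ct * Cd + 1 := by
  simpa [Ct, Cd] using RingQuot.mkAlgHom_rel ℂ CRel.dt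

/-- `t` as a unit of `D`. -/
noncomputable def CtUnit : DTorusˣ := ⟨Ct, Ctinv, Ct_mul_Ctinv, Ctinv_mul_Ct⟩

/-- A subalgebra of `D` containing the generators is everything. -/
lemma DTorus.induction {P : DTorus → Prop} (algebraMap : ∀ c, P (algebraMap ℂ DTorus c))
    (t : P Ct) (tinv : P Ctinv) (d : P Cd) (add : ∀ x y, P x → P y → P (x + y))
    (mul : ∀ x y, P x → P y → P (x * y)) (x : DTorus) : P x := by
  obtain ⟨y, rfl⟩ := RingQuot.mkAlgHom_surjective ℂ CRel x
  induction y using FreeAlgebra.induction with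
  | grade0 c => simpa only [AlgHom.commutes] using algebraMap c
  | grade1 g => cases g <;> assumption
  | mul a b ha hb => simpa only [map_mul] using mul _ _ ha hb
  | add a b ha hb => simpa only [map_add] using add _ _ ha hb

lemma theta_mul_Ct_zpow (k : ℤ) :
    Cd * Ct * ((CtUnit ^ k : DTorusˣ) : DTorus) =
      ((CtUnit ^ k : DTorusˣ) : DTorus) * (Cd * Ct + algebraMap ℂ DTorus k) := by
  have step : Cd * Ct * Ct = Ct * (Cd * Ct + 1) := by
    rw [mul_add, mul_one, ← mul_assoc, ← add_one_mul, ← Cd_mul_Ct]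
  have succ (j : ℤ) : ((CtUnit ^ (j + 1) : DTorusˣ) : DTorus) =
      ((CtUnit ^ j : DTorusˣ) : DTorus) * Ct := by
    rw [zpow_add_one]; rfl
  have comm (j : ℤ) : (Cd * Ct + algebraMap ℂ DTorus j) * Ct =
      Ct * (Cd * Ct + algebraMap ℂ DTorus ((j + 1 : ℤ) : ℂ)) := by
    rw [add_mul, step, Algebra.commutes, Int.cast_add, Int.cast_one]
    rw [map_add (algebraMap ℂ DTorus), map_one]
    noncomm_ring
  induction k using Int.induction_on with
  | zero => simp
  | succ j ih => rw [succ, ← mul_assoc, ih, mul_assoc, comm, mul_assoc]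
  | pred j ih =>
    have h := succ (-(j : ℤ) - 1)
    rw [sub_add_cancel] at h
    rw [h] at ih
    have c := comm (-(j : ℤ) - 1)
    rw [sub_add_cancel] at c
    refine CtUnit.isUnit.mul_right_cancel ?_
    change _ * Ct = _ * Ct
    rw [mul_assoc, ih, mul_assoc, mul_assoc, c]

/-- The basis vector `t ^ k` of `M(β)`. -/
noncomputable def monomialClass (β : ℂ) (k : ℤ) : Mtw β :=
  Submodule.Quotient.mk ((CtUnit ^ k : DTorusˣ) : DTorus)

lemma Ct_smul_monomialClass (β : ℂ) (k : ℤ) :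
    Ct • monomialClass β k = monomialClass β (k + 1) := by
  rw [monomialClass, monomialClass, ← Submodule.Quotient.mk_smul, smul_eq_mul, add_comm,
    zpow_one_add]
  rfl

lemma Ctinv_smul_monomialClass (β : ℂ) (k : ℤ) :
    Ctinv • monomialClass β k = monomialClass β (k - 1) := by
  rw [← sub_add_cancel k 1, ← Ct_smul_monomialClass, smul_smul, Ctinv_mul_Ct, one_smul,
    sub_add_cancel]

lemma theta_smul_monomialClass (β : ℂ) (k : ℤ) :
    (Cd * Ct) • monomialClass β k = ((k : ℂ) - β) • monomialClass β k := by
  rw [monomialClass, ← Submodule.Quotient.mk_smul, ← Submodule.Quotient.mk_smul,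
    Submodule.Quotient.eq, smul_eq_mul, theta_mul_Ct_zpow]
  refine Submodule.mem_span_singleton.mpr ⟨((CtUnit ^ k : DTorusˣ) : DTorus), ?_⟩
  rw [smul_eq_mul, Algebra.smul_def, Algebra.commutes, ← mul_sub, map_sub]
  congr 1
  abel

lemma Cd_smul_monomialClass (β : ℂ) (k : ℤ) :
    Cd • monomialClass β k = ((k : ℂ) - 1 - β) • monomialClass β (k - 1) := by
  have h := theta_smul_monomialClass β (k - 1)
  rw [mul_smul, Ct_smul_monomialClass, sub_add_cancel] at h
  simpa using h

/-- The action of `D` on `ℤ →₀ ℂ`, the twisted Laurent polynomials. -/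
noncomputable def laurentAction (β : ℂ) : DTorus →ₐ[ℂ] Module.End ℂ (ℤ →₀ ℂ) :=
  RingQuot.liftAlgHom ℂ ⟨FreeAlgebra.lift ℂ fun
    | CGen.t => Finsupp.lmapDomain ℂ ℂ (· + 1)
    | CGen.tinv => Finsupp.lmapDomain ℂ ℂ (· - 1)
    | CGen.dd => Finsupp.lsum ℂ fun k : ℤ => ((k : ℂ) - 1 - β) • Finsupp.lsingle (k - 1), by
    rintro _ _ (_ | _ | _) <;> ext k : 2
    · simp [Finsupp.mapDomain_single]
    · simp [Finsupp.mapDomain_single]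
    · simp [-Finsupp.single_sub, Finsupp.mapDomain_single, ← Finsupp.single_add]
      ring_nf⟩

lemma laurentAction_Ct (β : ℂ) (k : ℤ) (c : ℂ) :
    laurentAction β Ct (Finsupp.single k c) = Finsupp.single (k + 1) c := by
  simp [laurentAction, Ct, Finsupp.mapDomain_single]

lemma laurentAction_Ctinv (β : ℂ) (k : ℤ) (c : ℂ) :
    laurentAction β Ctinv (Finsupp.single k c) = Finsupp.single (k - 1) c := by
  simp [laurentAction, Ctinv, Finsupp.mapDomain_single]

lemma laurentAction_Cd (β : ℂ) (k : ℤ) (c : ℂ) :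
    laurentAction β Cd (Finsupp.single k c) =
      ((k : ℂ) - 1 - β) • Finsupp.single (k - 1) c := by
  simp [laurentAction, Cd]

lemma laurentAction_theta_apply (β : ℂ) (v : ℤ →₀ ℂ) (k : ℤ) :
    laurentAction β (Cd * Ct) v k = ((k : ℂ) - β) * v k := by
  induction v using Finsupp.induction_linear with
  | zero => simp
  | add u w hu hw => rw [map_add, Finsupp.add_apply, hu, hw, Finsupp.add_apply, mul_add]
  | single j c =>
    rw [map_mul, Module.End.mul_apply, laurentAction_Ct, laurentAction_Cd]
    rcases eq_or_ne j k with rfl | h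
    · simp
    · simp [h]

/-- The linear map sending the basis vector at `k` to the class of `t ^ k`. -/
noncomputable def ofLaurent (β : ℂ) : (ℤ →₀ ℂ) →ₗ[ℂ] Mtw β :=
  Finsupp.linearCombination ℂ (monomialClass β)

lemma ofLaurent_single (β : ℂ) (k : ℤ) (c : ℂ) :
    ofLaurent β (Finsupp.single k c) = c • monomialClass β k :=
  Finsupp.linearCombination_single ℂ c k

lemma ofLaurent_single_one (β : ℂ) (k : ℤ) :
    ofLaurent β (Finsupp.single k 1) = monomialClass β k := by
  rw [ofLaurent_single, monomialClass, ← Submodule.Quotient.mk_smul, one_smul]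

lemma ofLaurent_laurentAction (β : ℂ) (x : DTorus) (v : ℤ →₀ ℂ) :
    ofLaurent β (laurentAction β x v) = x • ofLaurent β v := by
  have gen (x : DTorus) (h : ∀ k, ofLaurent β (laurentAction β x (Finsupp.single k 1)) =
      x • monomialClass β k) (v : ℤ →₀ ℂ) :
      ofLaurent β (laurentAction β x v) = x • ofLaurent β v := by
    induction v using Finsupp.induction_linear with
    | zero => simp
    | add u w hu hw => simp only [map_add, hu, hw, smul_add]
    | single j c =>
      rw [← mul_one c, ← smul_eq_mul, ← Finsupp.smul_single, map_smul, map_smul, map_smul, h,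
        ofLaurent_single_one, smul_comm]
  induction x using DTorus.induction generalizing v with
  | algebraMap c =>
    rw [AlgHom.commutes, Module.algebraMap_end_apply, map_smul, algebraMap_smul]
  | t => exact gen _ (fun k => by
      rw [laurentAction_Ct, ofLaurent_single_one, Ct_smul_monomialClass]) v
  | tinv => exact gen _ (fun k => by
      rw [laurentAction_Ctinv, ofLaurent_single_one, Ctinv_smul_monomialClass]) v
  | d => exact gen _ (fun k => by
      rw [laurentAction_Cd, map_smul, ofLaurent_single_one, Cd_smul_monomialClass]) v
  | add x y hx hy => rw [map_add, LinearMap.add_apply, map_add, hx, hy, add_smul]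
  | mul x y hx hy => rw [map_mul, Module.End.mul_apply, hx, hy, mul_smul]

/-- The linear map `M(β) → ℤ →₀ ℂ` given by acting on the basis vector at `0`. -/
noncomputable def toLaurent (β : ℂ) : Mtw β →ₗ[ℂ] (ℤ →₀ ℂ) :=
  Submodule.liftQ ((twistIdeal β).restrictScalars ℂ)
    ((LinearMap.applyₗ (Finsupp.single 0 1)).comp (laurentAction β).toLinearMap) (by
      intro x hx
      rcases Submodule.mem_span_singleton.mp hx with ⟨q, rfl⟩
      suffices h : laurentAction β (Cd * Ct + algebraMap ℂ DTorus β) (Finsupp.single 0 1) = 0 by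
        simpa [-map_add] using congrArg (laurentAction β q) h
      ext k
      rw [map_add, LinearMap.add_apply, Finsupp.add_apply, laurentAction_theta_apply,
        AlgHom.commutes, Module.algebraMap_end_apply, Finsupp.smul_apply, smul_eq_mul]
      rcases eq_or_ne 0 k with rfl | h
      · simp
      · simp [h])

lemma toLaurent_mk (β : ℂ) (x : DTorus) :
    toLaurent β (Submodule.Quotient.mk x) = laurentAction β x (Finsupp.single 0 1) := rfl

lemma toLaurent_monomialClass (β : ℂ) (k : ℤ) :
    toLaurent β (monomialClass β k) = Finsupp.single k 1 := by
  have shift (j : ℤ) : toLaurent β (monomialClass β (j + 1)) =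
      laurentAction β Ct (toLaurent β (monomialClass β j)) := by
    rw [← Ct_smul_monomialClass, monomialClass, ← Submodule.Quotient.mk_smul, toLaurent_mk,
      toLaurent_mk, smul_eq_mul, map_mul, Module.End.mul_apply]
  induction k using Int.induction_on with
  | zero => simp [monomialClass, toLaurent_mk]
  | succ j ih => rw [shift, ih, laurentAction_Ct]
  | pred j ih =>
    have h := congrArg (laurentAction β Ctinv) (shift (-(j : ℤ) - 1))
    rw [sub_add_cancel, ih, laurentAction_Ctinv, ← Module.End.mul_apply, ← map_mul,
      Ctinv_mul_Ct, map_one, Module.End.one_apply] at h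
    exact h.symm

/-- The classes of the powers of `t` form a basis of `M(β)`. -/
noncomputable def laurentEquiv (β : ℂ) : (ℤ →₀ ℂ) ≃ₗ[ℂ] Mtw β :=
  LinearEquiv.ofLinearMap (ofLaurent β) (toLaurent β)
    (by
      refine LinearMap.ext fun m => ?_
      obtain ⟨x, rfl⟩ := Submodule.Quotient.mk_surjective _ m
      rw [LinearMap.comp_apply, toLaurent_mk, ofLaurent_laurentAction, ofLaurent_single_one,
        monomialClass, ← Submodule.Quotient.mk_smul]
      simp)
    (by
      ext k : 2
      simp [ofLaurent_single, toLaurent_monomialClass])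

lemma thetaMap_laurentEquiv (β : ℂ) (v : ℤ →₀ ℂ) :
    thetaMap β (laurentEquiv β v) = laurentEquiv β (laurentAction β (Cd * Ct) v) := by
  have h (m : Mtw β) : thetaMap β m = (Cd * Ct) • m := by
    obtain ⟨x, rfl⟩ := Submodule.Quotient.mk_surjective _ m
    rfl
  rw [h]
  exact (ofLaurent_laurentAction β _ v).symm

lemma laurentEquiv_symm_thetaMap (β : ℂ) (m : Mtw β) (k : ℤ) :
    (laurentEquiv β).symm (thetaMap β m) k = ((k : ℂ) - β) * (laurentEquiv β).symm m k := by
  obtain ⟨v, rfl⟩ := (laurentEquiv β).surjective m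
  rw [thetaMap_laurentEquiv, LinearEquiv.symm_apply_apply, LinearEquiv.symm_apply_apply,
    laurentAction_theta_apply]

lemma mem_range_thetaMap (β : ℂ) (m : Mtw β)
    (h : ∀ k : ℤ, (k : ℂ) = β → (laurentEquiv β).symm m k = 0) :
    m ∈ LinearMap.range (thetaMap β) := by
  set v := (laurentEquiv β).symm m with hv
  let w : ℤ →₀ ℂ := Finsupp.onFinset v.support (fun k => ((k : ℂ) - β)⁻¹ * v k)
    (fun k hk => Finsupp.mem_support_iff.mpr (right_ne_zero_of_mul hk))
  refine ⟨laurentEquiv β w, (laurentEquiv β).symm.injective (Finsupp.ext fun k => ?_)⟩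
  rw [laurentEquiv_symm_thetaMap, LinearEquiv.symm_apply_apply, ← hv]
  change ((k : ℂ) - β) * (((k : ℂ) - β)⁻¹ * v k) = v k
  by_cases hk : (k : ℂ) = β
  · simp [h k hk]
  · rw [mul_inv_cancel_left₀ (sub_ne_zero.mpr hk)]

lemma finrank_ker_thetaMap_intCast (n : ℤ) :
    Module.finrank ℂ (LinearMap.ker (thetaMap (n : ℂ))) = 1 := by
  have hker : LinearMap.ker (thetaMap (n : ℂ)) =
      Submodule.span ℂ {laurentEquiv n (Finsupp.single n 1)} := by
    ext m
    rw [LinearMap.mem_ker, Submodule.mem_span_singleton]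
    constructor
    · intro hm
      refine ⟨(laurentEquiv n).symm m n, (laurentEquiv n).symm.injective
        (Finsupp.ext fun k => ?_)⟩
      rw [map_smul, LinearEquiv.symm_apply_apply]
      rcases eq_or_ne n k with rfl | hk
      · simp
      · have h := laurentEquiv_symm_thetaMap n m k
        rw [hm, map_zero, Finsupp.zero_apply, eq_comm, mul_eq_zero, sub_eq_zero,
          Int.cast_inj] at h
        simp [h.resolve_left hk.symm, hk]
    · rintro ⟨c, rfl⟩
      refine (laurentEquiv n).symm.injective (Finsupp.ext fun k => ?_)
      rw [laurentEquiv_symm_thetaMap, map_smul, LinearEquiv.symm_apply_apply]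
      rcases eq_or_ne n k with rfl | hk
      · simp
      · simp [hk]
  rw [hker, finrank_span_singleton]
  simp

lemma finrank_coker_thetaMap_intCast (n : ℤ) :
    Module.finrank ℂ (Mtw (n : ℂ) ⧸ LinearMap.range (thetaMap (n : ℂ))) = 1 := by
  let l : Mtw (n : ℂ) →ₗ[ℂ] ℂ := (Finsupp.lapply n).comp (laurentEquiv n).symm.toLinearMap
  have hl (m : Mtw (n : ℂ)) : l m = (laurentEquiv n).symm m n := rfl
  have hrange : LinearMap.range (thetaMap (n : ℂ)) = LinearMap.ker l := by
    refine le_antisymm ?_ fun m hm => mem_range_thetaMap n m fun k hk => ?_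
    · rintro _ ⟨m, rfl⟩
      rw [LinearMap.mem_ker, hl, laurentEquiv_symm_thetaMap, sub_self, zero_mul]
    · rw [Int.cast_injective hk]
      exact hm
  have hsurj : Function.Surjective l := fun c =>
    ⟨laurentEquiv n (Finsupp.single n c), by simp [hl]⟩
  rw [hrange, (l.quotKerEquivOfSurjective hsurj).finrank_eq, Module.finrank_self]

/-- Left multiplication by `∂t` on `M(β)` is bijective iff `β ∉ ℤ`; if `β ∈ ℤ`, the
kernel and cokernel are both one-dimensional (i.e. the two homology groups of the
two-term Koszul complex of `∂t` on `M(β)` are one-dimensional). -/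
theorem torus_twist_bijective_iff (β : ℂ) :
    (Function.Bijective (thetaMap β) ↔ ∀ m : ℤ, β ≠ (m : ℂ)) ∧
    ((∃ m : ℤ, β = (m : ℂ)) →
      Module.finrank ℂ (LinearMap.ker (thetaMap β)) = 1 ∧
      Module.finrank ℂ (Mtw β ⧸ LinearMap.range (thetaMap β)) = 1) := by
  refine ⟨⟨?_, fun h => ⟨?_, fun m => ?_⟩⟩, ?_⟩
  · rintro h m rfl
    have hk := finrank_ker_thetaMap_intCast m
    rw [LinearMap.ker_eq_bot.mpr h.injective, finrank_bot] at hk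
    exact zero_ne_one hk
  · refine (injective_iff_map_eq_zero _).mpr fun m hm =>
      (laurentEquiv β).symm.injective (Finsupp.ext fun k => ?_)
    have hk := laurentEquiv_symm_thetaMap β m k
    rw [hm, map_zero, Finsupp.zero_apply, eq_comm, mul_eq_zero, sub_eq_zero] at hk
    rw [map_zero, Finsupp.zero_apply]
    exact hk.resolve_left (h k).symm
  · exact mem_range_thetaMap β m fun k hk => absurd hk.symm (h k)
  · rintro ⟨m, rfl⟩
    exact ⟨finrank_ker_thetaMap_intCast m, finrank_coker_thetaMap_intCast m⟩
end
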